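/- With the functions f_A and f_B defined on subsets T ⊆ O_K of the K-th layer of a layered linear deterministic network, both f_A and f_B are submodular and nondecreasing set functions, and f_A(∅) = f_B(∅) = 0. -/

import Mathlib

open Matrix

/-- The rank of the block submatrix of `G` formed by the rows whose row-block index lies in `W`
and the columns whose column-block index lies in `U`. -/
noncomputable def blockRank {F : Type*} [Field F] {ρ γ ι κ : Type*} [Fintype ρ] [Fintype γ]
    [DecidableEq ι] [DecidableEq κ]
    (G : Matrix ρ γ F) (rblk : ρ → κ) (cblk : γ → ι)
    (W : Finset κ) (U : Finset ι) : ℕ :=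
  (G.submatrix (fun r : {r : ρ // rblk r ∈ W} => r.1)
               (fun c : {c : γ // cblk c ∈ U} => c.1)).rank

/-- A block matrix `G` supports the flow `(ℓ; ℓ')` of rate `R` if there is an invertible `R × R`
submatrix of `G` using exactly `ℓ j` columns from the `j`-th column block and exactly
`ℓ' k` rows from the `k`-th row block. -/
def SupportsFlow {F : Type*} [Field F] {ρ γ ι κ : Type*} [DecidableEq ι] [DecidableEq κ]
    (G : Matrix ρ γ F) (rblk : ρ → κ) (cblk : γ → ι)
    (ℓ : ι → ℕ) (ℓ' : κ → ℕ) (R : ℕ) : Prop :=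
  ∃ (r : Fin R → ρ) (c : Fin R → γ),
    Function.Injective r ∧ Function.Injective c ∧
    (∀ k : κ, (Finset.univ.filter fun i => rblk (r i) = k).card = ℓ' k) ∧
    (∀ j : ι, (Finset.univ.filter fun i => cblk (c i) = j).card = ℓ j) ∧
    IsUnit (G.submatrix r c)

section Network

/- A layered linear deterministic network with `M + 1` layers indexed by `Fin (M+1)`, where layer
`i` has `m i` nodes, and for each hop `i : Fin M` a block matrix `G i` whose column blocks are
indexed by the nodes of layer `i.castSucc` and whose row blocks are indexed by the nodes of
layer `i.succ`. -/
variable {F : Type*} [Field F] {M : ℕ} {m : Fin (M + 1) → ℕ}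
  {ρ γ : Fin M → Type*}

/-- The capacity `C(Ω) = ∑_i rank (G_i(Ω))` of a cut `Ω`, where `G_i(Ω)` consists of the column
blocks of `G i` indexed by `Ω ∩ O_i` and the row blocks indexed by `O_{i+1} ∖ Ω`. -/
noncomputable def cutCap [∀ i, Fintype (ρ i)] [∀ i, Fintype (γ i)]
    (G : ∀ i : Fin M, Matrix (ρ i) (γ i) F)
    (rblk : ∀ i : Fin M, ρ i → Fin (m i.succ))
    (cblk : ∀ i : Fin M, γ i → Fin (m i.castSucc))
    (Ω : ∀ i : Fin (M + 1), Finset (Fin (m i))) : ℕ :=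
  ∑ i : Fin M, blockRank (G i) (rblk i) (cblk i) ((Ω i.succ)ᶜ) (Ω i.castSucc)

/-- The network supports the rate-`R` flow `(ℓfirst; ℓlast)` if there are per-layer nonnegative
integers `ℓ i`, agreeing with `ℓfirst` on the first layer and with `ℓlast` on the last layer,
such that every block matrix `G i` supports the flow `(ℓ i.castSucc; ℓ i.succ)` of rate `R`. -/
def NetSupports [∀ i, Fintype (ρ i)] [∀ i, Fintype (γ i)]
    (G : ∀ i : Fin M, Matrix (ρ i) (γ i) F)
    (rblk : ∀ i : Fin M, ρ i → Fin (m i.succ))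
    (cblk : ∀ i : Fin M, γ i → Fin (m i.castSucc))
    (ℓfirst : Fin (m 0) → ℕ) (ℓlast : Fin (m (Fin.last M)) → ℕ) (R : ℕ) : Prop :=
  ∃ ℓ : ∀ i : Fin (M + 1), Fin (m i) → ℕ,
    ℓ 0 = ℓfirst ∧ ℓ (Fin.last M) = ℓlast ∧
    ∀ i : Fin M, SupportsFlow (G i) (rblk i) (cblk i) (ℓ i.castSucc) (ℓ i.succ) R

end Network

section fAfB

variable {F : Type*} [Field F] {M : ℕ} {m : Fin (M + 1) → ℕ} {ρ γ : Fin M → Type*}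
  [∀ i, Fintype (ρ i)] [∀ i, Fintype (γ i)]

/-- `f_A(T)`: the minimum, over all cuts `Ω_A` of the subnetwork `N_A` on layers `O_1,…,O_K`
with `O_K ∖ Ω_A = T`, of `C(Ω_A) − ∑_{O_1(j) ∈ Ω_A} ℓ₁ j + R`.  (A cut of `N_A` is encoded by
its extension to the whole node set; only the layers of `N_A` enter the condition and the
value.) -/
noncomputable def fA (G : ∀ i : Fin M, Matrix (ρ i) (γ i) F)
    (rblk : ∀ i : Fin M, ρ i → Fin (m i.succ))
    (cblk : ∀ i : Fin M, γ i → Fin (m i.castSucc))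
    (K : Fin (M + 1)) (ℓ₁ : Fin (m 0) → ℕ) (R : ℕ) (T : Finset (Fin (m K))) : ℤ :=
  sInf {z : ℤ | ∃ Ω : ∀ i : Fin (M + 1), Finset (Fin (m i)),
    Finset.univ \ Ω K = T ∧
    z = (∑ i ∈ Finset.univ.filter (fun i : Fin M => (i : ℕ) + 1 ≤ (K : ℕ)),
          (blockRank (G i) (rblk i) (cblk i) ((Ω i.succ)ᶜ) (Ω i.castSucc) : ℤ))
        - (∑ j ∈ Ω 0, (ℓ₁ j : ℤ)) + R}

/-- `f_B(T)`: the minimum, over all cuts `Ω_B` of the subnetwork `N_B` on layers `O_K,…,O_M`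
with `O_K ∩ Ω_B = T`, of `C(Ω_B) − ∑_{O_M(k) ∉ Ω_B} ℓ_M k + R`.  (A cut of `N_B` is encoded by
its extension to the whole node set; only the layers of `N_B` enter the condition and the
value.) -/
noncomputable def fB (G : ∀ i : Fin M, Matrix (ρ i) (γ i) F)
    (rblk : ∀ i : Fin M, ρ i → Fin (m i.succ))
    (cblk : ∀ i : Fin M, γ i → Fin (m i.castSucc))
    (K : Fin (M + 1)) (ℓM : Fin (m (Fin.last M)) → ℕ) (R : ℕ) (T : Finset (Fin (m K))) : ℤ :=
  sInf {z : ℤ | ∃ Ω : ∀ i : Fin (M + 1), Finset (Fin (m i)),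
    Ω K = T ∧
    z = (∑ i ∈ Finset.univ.filter (fun i : Fin M => (K : ℕ) ≤ (i : ℕ)),
          (blockRank (G i) (rblk i) (cblk i) ((Ω i.succ)ᶜ) (Ω i.castSucc) : ℤ))
        - (∑ k ∈ (Ω (Fin.last M))ᶜ, (ℓM k : ℤ)) + R}

end fAfB

section BlockRank

variable {F : Type*} [Field F] {ρ γ ι κ : Type*}

/-- The linear map restricting a vector to the coordinates in `W`. -/
def restrictCoords (F : Type*) [Field F] {ρ κ : Type*} (rblk : ρ → κ) (W : Finset κ) :
    (ρ → F) →ₗ[F] ({r : ρ // rblk r ∈ W} → F) :=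
  LinearMap.funLeft F F Subtype.val

/-- The span of the columns of `G` whose block index lies in `U`. -/
def blockColSpan (G : Matrix ρ γ F) (cblk : γ → ι) (U : Finset ι) : Submodule F (ρ → F) :=
  Submodule.span F (G.col '' {c | cblk c ∈ U})

lemma mem_ker_restrictCoords {rblk : ρ → κ} {W : Finset κ} {v : ρ → F} :
    v ∈ LinearMap.ker (restrictCoords F rblk W) ↔ ∀ r, rblk r ∈ W → v r = 0 := by
  simp [restrictCoords, funext_iff, LinearMap.funLeft_apply]

lemma blockColSpan_mono (G : Matrix ρ γ F) (cblk : γ → ι) {U U' : Finset ι} (h : U ⊆ U') :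
    blockColSpan G cblk U ≤ blockColSpan G cblk U' :=
  Submodule.span_mono (Set.image_mono fun _ hc => h hc)

variable [DecidableEq ι] [DecidableEq κ]

lemma blockColSpan_union (G : Matrix ρ γ F) (cblk : γ → ι) (U U' : Finset ι) :
    blockColSpan G cblk (U ∪ U') = blockColSpan G cblk U ⊔ blockColSpan G cblk U' := by
  rw [blockColSpan, blockColSpan, blockColSpan, ← Submodule.span_union, ← Set.image_union]
  congr 2
  ext c
  simp

variable [Fintype ρ] [Fintype γ]

lemma blockRank_eq_finrank_map (G : Matrix ρ γ F) (rblk : ρ → κ) (cblk : γ → ι)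
    (W : Finset κ) (U : Finset ι) :
    blockRank G rblk cblk W U =
      Module.finrank F ((blockColSpan G cblk U).map (restrictCoords F rblk W)) := by
  have h : Set.range (G.submatrix (fun r : {r : ρ // rblk r ∈ W} => r.1)
      (fun c : {c : γ // cblk c ∈ U} => c.1)).col =
      restrictCoords F rblk W '' (G.col '' {c | cblk c ∈ U}) := by
    ext v
    constructor
    · rintro ⟨c, rfl⟩
      exact ⟨_, ⟨c.1, c.2, rfl⟩, rfl⟩
    · rintro ⟨_, ⟨c, hc, rfl⟩, rfl⟩
      exact ⟨⟨c, hc⟩, rfl⟩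
  rw [blockRank, Matrix.rank_eq_finrank_span_cols, blockColSpan, Submodule.map_span, h]

lemma blockRank_add_finrank_ker (G : Matrix ρ γ F) (rblk : ρ → κ) (cblk : γ → ι)
    (W : Finset κ) (U : Finset ι) :
    blockRank G rblk cblk W U + Module.finrank F (LinearMap.ker (restrictCoords F rblk W)) =
      Module.finrank F
        (blockColSpan G cblk U ⊔ LinearMap.ker (restrictCoords F rblk W) : Submodule F (ρ → F)) := by
  set f := restrictCoords F rblk W
  set V := blockColSpan G cblk U
  have h := LinearMap.finrank_range_add_finrank_ker (f.domRestrict (V ⊔ LinearMap.ker f))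
  rw [LinearMap.range_domRestrict, Submodule.map_sup, LinearMap.ker_domRestrict,
    (LinearMap.le_ker_iff_map (f := f)).1 le_rfl, sup_bot_eq,
    (Submodule.comapSubtypeEquivOfLe (le_sup_right : LinearMap.ker f ≤ V ⊔ _)).finrank_eq] at h
  rw [blockRank_eq_finrank_map, h]

lemma blockRank_submodular (G : Matrix ρ γ F) (rblk : ρ → κ) (cblk : γ → ι)
    (W₁ W₂ : Finset κ) (U₁ U₂ : Finset ι) :
    blockRank G rblk cblk (W₁ ∩ W₂) (U₁ ∪ U₂) + blockRank G rblk cblk (W₁ ∪ W₂) (U₁ ∩ U₂) ≤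
      blockRank G rblk cblk W₁ U₁ + blockRank G rblk cblk W₂ U₂ := by
  have e₁ := blockRank_add_finrank_ker G rblk cblk W₁ U₁
  have e₂ := blockRank_add_finrank_ker G rblk cblk W₂ U₂
  have e₃ := blockRank_add_finrank_ker G rblk cblk (W₁ ∩ W₂) (U₁ ∪ U₂)
  have e₄ := blockRank_add_finrank_ker G rblk cblk (W₁ ∪ W₂) (U₁ ∩ U₂)
  rw [blockColSpan_union] at e₃
  have hinter : LinearMap.ker (restrictCoords F rblk (W₁ ∩ W₂)) =
      LinearMap.ker (restrictCoords F rblk W₁) ⊔ LinearMap.ker (restrictCoords F rblk W₂) := by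
    apply le_antisymm
    · intro v hv
      rw [mem_ker_restrictCoords] at hv
      refine Submodule.mem_sup.2 ⟨fun r => if rblk r ∈ W₁ then 0 else v r, ?_,
        fun r => if rblk r ∈ W₁ then v r else 0, ?_, ?_⟩
      · rw [mem_ker_restrictCoords]
        intro r hr
        simp [hr]
      · rw [mem_ker_restrictCoords]
        intro r hr
        have := hv r
        simp_all
      · ext r
        by_cases h : rblk r ∈ W₁ <;> simp [h]
    · refine sup_le ?_ ?_ <;> intro v hv <;> rw [mem_ker_restrictCoords] at hv ⊢ <;>
        intro r hr <;> exact hv r (by simp_all)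
  have hunion : LinearMap.ker (restrictCoords F rblk (W₁ ∪ W₂)) =
      LinearMap.ker (restrictCoords F rblk W₁) ⊓ LinearMap.ker (restrictCoords F rblk W₂) := by
    ext v
    simp only [Submodule.mem_inf, mem_ker_restrictCoords, Finset.mem_union, or_imp, forall_and]
  rw [hinter] at e₃
  rw [hunion] at e₄
  have hU₁ : blockColSpan G cblk (U₁ ∩ U₂) ≤ blockColSpan G cblk U₁ :=
    blockColSpan_mono G cblk Finset.inter_subset_left
  have hU₂ : blockColSpan G cblk (U₁ ∩ U₂) ≤ blockColSpan G cblk U₂ :=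
    blockColSpan_mono G cblk Finset.inter_subset_right
  rw [sup_sup_sup_comm] at e₃
  generalize blockColSpan G cblk (U₁ ∩ U₂) = V at *
  generalize blockColSpan G cblk U₁ = V₁ at *
  generalize blockColSpan G cblk U₂ = V₂ at *
  generalize LinearMap.ker (restrictCoords F rblk W₁) = Z₁ at *
  generalize LinearMap.ker (restrictCoords F rblk W₂) = Z₂ at *
  have d₁ := Submodule.finrank_sup_add_finrank_inf_eq Z₁ Z₂
  have d₂ := Submodule.finrank_sup_add_finrank_inf_eq (V₁ ⊔ Z₁) (V₂ ⊔ Z₂)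
  have d₃ : Module.finrank F (V ⊔ Z₁ ⊓ Z₂ : Submodule F (ρ → F)) ≤
      Module.finrank F ((V₁ ⊔ Z₁) ⊓ (V₂ ⊔ Z₂) : Submodule F (ρ → F)) :=
    Submodule.finrank_mono
      (le_inf (sup_le_sup hU₁ inf_le_left) (sup_le_sup hU₂ inf_le_right))
  omega

lemma blockRank_empty_right (G : Matrix ρ γ F) (rblk : ρ → κ) (cblk : γ → ι) (W : Finset κ) :
    blockRank G rblk cblk W ∅ = 0 := by
  have h : {c : γ | cblk c ∈ (∅ : Finset ι)} = ∅ := by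
    ext c
    simp
  rw [blockRank_eq_finrank_map, blockColSpan, h, Set.image_empty, Submodule.span_empty,
    Submodule.map_bot, finrank_bot]

lemma blockRank_empty_left (G : Matrix ρ γ F) (rblk : ρ → κ) (cblk : γ → ι) (U : Finset ι) :
    blockRank G rblk cblk ∅ U = 0 := by
  have : IsEmpty {r : ρ // rblk r ∈ (∅ : Finset κ)} := ⟨fun r => by simpa using r.2⟩
  rw [blockRank_eq_finrank_map]
  exact Module.finrank_zero_of_subsingleton

lemma blockRank_mono (G : Matrix ρ γ F) (rblk : ρ → κ) (cblk : γ → ι)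
    {W W' : Finset κ} {U U' : Finset ι} (hW : W ⊆ W') (hU : U ⊆ U') :
    blockRank G rblk cblk W U ≤ blockRank G rblk cblk W' U' := by
  have h₁ := blockRank_submodular G rblk cblk W' W U ∅
  simp only [Finset.inter_eq_right.2 hW, Finset.union_eq_left.2 hW, Finset.union_empty,
    Finset.inter_empty, blockRank_empty_right, add_zero] at h₁
  refine h₁.trans ?_
  rw [blockRank_eq_finrank_map, blockRank_eq_finrank_map]
  exact Submodule.finrank_mono (Submodule.map_mono (blockColSpan_mono G cblk hU))

end BlockRank

section FiberMin

variable {α β : Type*} {p : α → β} {c : α → ℤ}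

lemma bddBelow_fiber_values (hc : ∀ a, 0 ≤ c a) (t : β) :
    BddBelow {z : ℤ | ∃ a, p a = t ∧ z = c a} :=
  ⟨0, by rintro z ⟨a, -, rfl⟩; exact hc a⟩

lemma exists_eq_sInf_fiber (hc : ∀ a, 0 ≤ c a) (hp : Function.Surjective p) (t : β) :
    ∃ a, p a = t ∧ sInf {z : ℤ | ∃ a, p a = t ∧ z = c a} = c a := by
  obtain ⟨a, ha⟩ := hp t
  exact Int.csInf_mem (s := {z : ℤ | ∃ a, p a = t ∧ z = c a}) ⟨c a, a, ha, rfl⟩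
    (bddBelow_fiber_values hc t)

lemma sInf_fiber_le (hc : ∀ a, 0 ≤ c a) {a : α} {t : β} (ha : p a = t) :
    sInf {z : ℤ | ∃ a, p a = t ∧ z = c a} ≤ c a :=
  csInf_le (bddBelow_fiber_values hc t) ⟨a, ha, rfl⟩

lemma sInf_fiber_mono (hc : ∀ a, 0 ≤ c a) (hp : Function.Surjective p) {s t : β}
    (h : ∀ a, p a = t → ∃ b, p b = s ∧ c b ≤ c a) :
    sInf {z : ℤ | ∃ a, p a = s ∧ z = c a} ≤ sInf {z : ℤ | ∃ a, p a = t ∧ z = c a} := by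
  obtain ⟨a, ha, e⟩ := exists_eq_sInf_fiber hc hp t
  obtain ⟨b, hb, hba⟩ := h a ha
  exact e ▸ (sInf_fiber_le hc hb).trans hba

lemma sInf_fiber_add_le (hc : ∀ a, 0 ≤ c a) (hp : Function.Surjective p) {s s' t t' : β}
    (h : ∀ a a', p a = t → p a' = t' →
      ∃ b b', p b = s ∧ p b' = s' ∧ c b + c b' ≤ c a + c a') :
    sInf {z : ℤ | ∃ a, p a = s ∧ z = c a} + sInf {z : ℤ | ∃ a, p a = s' ∧ z = c a} ≤
      sInf {z : ℤ | ∃ a, p a = t ∧ z = c a} + sInf {z : ℤ | ∃ a, p a = t' ∧ z = c a} := by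
  obtain ⟨a, ha, e⟩ := exists_eq_sInf_fiber hc hp t
  obtain ⟨a', ha', e'⟩ := exists_eq_sInf_fiber hc hp t'
  obtain ⟨b, b', hb, hb', hle⟩ := h a a' ha ha'
  rw [e, e']
  exact (add_le_add (sInf_fiber_le hc hb) (sInf_fiber_le hc hb')).trans hle

lemma sInf_fiber_eq_zero (hc : ∀ a, 0 ≤ c a) {a : α} {t : β} (ha : p a = t) (h : c a = 0) :
    sInf {z : ℤ | ∃ a, p a = t ∧ z = c a} = 0 := by
  apply le_antisymm
  · exact h ▸ sInf_fiber_le hc ha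
  · refine le_csInf ⟨c a, a, ha, rfl⟩ ?_
    rintro z ⟨b, -, rfl⟩
    exact hc b

end FiberMin

section CutCost

variable {F : Type*} [Field F] {M : ℕ} {m : Fin (M + 1) → ℕ} {ρ γ : Fin M → Type*}
  [∀ i, Fintype (ρ i)] [∀ i, Fintype (γ i)]

lemma sum_blockRank_submodular (G : ∀ i : Fin M, Matrix (ρ i) (γ i) F)
    (rblk : ∀ i : Fin M, ρ i → Fin (m i.succ)) (cblk : ∀ i : Fin M, γ i → Fin (m i.castSucc))
    (I : Finset (Fin M)) (Ω Ω' : ∀ i : Fin (M + 1), Finset (Fin (m i))) :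
    (∑ i ∈ I, (blockRank (G i) (rblk i) (cblk i) (((Ω ⊔ Ω') i.succ)ᶜ) ((Ω ⊔ Ω') i.castSucc) : ℤ)) +
      ∑ i ∈ I, (blockRank (G i) (rblk i) (cblk i) (((Ω ⊓ Ω') i.succ)ᶜ) ((Ω ⊓ Ω') i.castSucc) : ℤ) ≤
    (∑ i ∈ I, (blockRank (G i) (rblk i) (cblk i) ((Ω i.succ)ᶜ) (Ω i.castSucc) : ℤ)) +
      ∑ i ∈ I, (blockRank (G i) (rblk i) (cblk i) ((Ω' i.succ)ᶜ) (Ω' i.castSucc) : ℤ) := by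
  rw [← Finset.sum_add_distrib, ← Finset.sum_add_distrib]
  refine Finset.sum_le_sum fun i _ => ?_
  have h := blockRank_submodular (G i) (rblk i) (cblk i) ((Ω i.succ)ᶜ) ((Ω' i.succ)ᶜ)
    (Ω i.castSucc) (Ω' i.castSucc)
  simp only [Pi.sup_apply, Pi.inf_apply, Finset.sup_eq_union, Finset.inf_eq_inter,
    Finset.compl_union, Finset.compl_inter]
  exact_mod_cast h

end CutCost

lemma sum_natCast_le_of_sum_eq {n R : ℕ} {ℓ : Fin n → ℕ} (h : ∑ j, ℓ j = R)
    (S : Finset (Fin n)) : ∑ j ∈ S, (ℓ j : ℤ) ≤ R := by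
  rw [← h]
  exact_mod_cast Finset.sum_le_sum_of_subset (Finset.subset_univ S)

/-- **Lemma 7.** The functions `f_A` and `f_B` on subsets of the `K`-th layer of a layered
linear deterministic network over a finite field are (I) submodular, (II) nondecreasing, and
(III) satisfy `f_A(∅) = 0` and `f_B(∅) = 0`. -/
theorem stmt_12 {F : Type*} [Field F] [Fintype F] {M : ℕ}
    {m : Fin (M + 1) → ℕ} {ρ γ : Fin M → Type*}
    [∀ i, Fintype (ρ i)] [∀ i, Fintype (γ i)]
    (G : ∀ i : Fin M, Matrix (ρ i) (γ i) F)
    (rblk : ∀ i : Fin M, ρ i → Fin (m i.succ))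
    (cblk : ∀ i : Fin M, γ i → Fin (m i.castSucc))
    (K : Fin (M + 1)) (hK1 : 1 ≤ (K : ℕ)) (hK2 : (K : ℕ) < M)
    (ℓ₁ : Fin (m 0) → ℕ) (ℓM : Fin (m (Fin.last M)) → ℕ) (R : ℕ)
    (h₁ : ∑ j, ℓ₁ j = R) (hM' : ∑ k, ℓM k = R) :
    (∀ T₁ T₂ : Finset (Fin (m K)),
      fA G rblk cblk K ℓ₁ R (T₁ ∩ T₂) + fA G rblk cblk K ℓ₁ R (T₁ ∪ T₂) ≤
        fA G rblk cblk K ℓ₁ R T₁ + fA G rblk cblk K ℓ₁ R T₂) ∧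
    (∀ T₁ T₂ : Finset (Fin (m K)),
      fB G rblk cblk K ℓM R (T₁ ∩ T₂) + fB G rblk cblk K ℓM R (T₁ ∪ T₂) ≤
        fB G rblk cblk K ℓM R T₁ + fB G rblk cblk K ℓM R T₂) ∧
    (∀ T₁ T₂ : Finset (Fin (m K)), T₁ ⊆ T₂ →
      fA G rblk cblk K ℓ₁ R T₁ ≤ fA G rblk cblk K ℓ₁ R T₂) ∧
    (∀ T₁ T₂ : Finset (Fin (m K)), T₁ ⊆ T₂ →
      fB G rblk cblk K ℓM R T₁ ≤ fB G rblk cblk K ℓM R T₂) ∧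
    fA G rblk cblk K ℓ₁ R ∅ = 0 ∧ fB G rblk cblk K ℓM R ∅ = 0 := by
  have hpB : Function.Surjective fun Ω : ∀ i : Fin (M + 1), Finset (Fin (m i)) => Ω K :=
    Function.surjective_eval K
  have hpA : Function.Surjective
      fun Ω : ∀ i : Fin (M + 1), Finset (Fin (m i)) => Finset.univ \ Ω K := by
    intro T
    obtain ⟨Ω, hΩ⟩ := hpB Tᶜ
    refine ⟨Ω, ?_⟩
    simp only [← Finset.compl_eq_univ_sdiff]
    exact (congrArg (·ᶜ) hΩ).trans (compl_compl T)
  have hcA : ∀ Ω : ∀ i : Fin (M + 1), Finset (Fin (m i)),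
      0 ≤ (∑ i ∈ Finset.univ.filter (fun i : Fin M => (i : ℕ) + 1 ≤ (K : ℕ)),
          (blockRank (G i) (rblk i) (cblk i) ((Ω i.succ)ᶜ) (Ω i.castSucc) : ℤ))
        - (∑ j ∈ Ω 0, (ℓ₁ j : ℤ)) + R := fun Ω => by
    have h := sum_natCast_le_of_sum_eq h₁ (Ω 0)
    have h' := Finset.sum_nonneg fun i (_ : i ∈ Finset.univ.filter
      (fun i : Fin M => (i : ℕ) + 1 ≤ (K : ℕ))) =>
        Int.natCast_nonneg (blockRank (G i) (rblk i) (cblk i) ((Ω i.succ)ᶜ) (Ω i.castSucc))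
    linarith
  have hcB : ∀ Ω : ∀ i : Fin (M + 1), Finset (Fin (m i)),
      0 ≤ (∑ i ∈ Finset.univ.filter (fun i : Fin M => (K : ℕ) ≤ (i : ℕ)),
          (blockRank (G i) (rblk i) (cblk i) ((Ω i.succ)ᶜ) (Ω i.castSucc) : ℤ))
        - (∑ k ∈ (Ω (Fin.last M))ᶜ, (ℓM k : ℤ)) + R := fun Ω => by
    have h := sum_natCast_le_of_sum_eq hM' (Ω (Fin.last M))ᶜ
    have h' := Finset.sum_nonneg fun i (_ : i ∈ Finset.univ.filter
      (fun i : Fin M => (K : ℕ) ≤ (i : ℕ))) =>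
        Int.natCast_nonneg (blockRank (G i) (rblk i) (cblk i) ((Ω i.succ)ᶜ) (Ω i.castSucc))
    linarith
  refine ⟨fun T₁ T₂ => ?_, fun T₁ T₂ => ?_, fun T₁ T₂ hT => ?_, fun T₁ T₂ hT => ?_, ?_, ?_⟩
  · refine sInf_fiber_add_le hcA hpA fun Ω Ω' hΩ hΩ' => ⟨Ω ⊔ Ω', Ω ⊓ Ω', ?_, ?_, ?_⟩
    · simp only [Pi.sup_apply, Finset.sup_eq_union, ← hΩ, ← hΩ', ← Finset.compl_eq_univ_sdiff,
        Finset.compl_union]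
    · simp only [Pi.inf_apply, Finset.inf_eq_inter, ← hΩ, ← hΩ', ← Finset.compl_eq_univ_sdiff,
        Finset.compl_inter]
    · have h := sum_blockRank_submodular G rblk cblk
        (Finset.univ.filter (fun i : Fin M => (i : ℕ) + 1 ≤ (K : ℕ))) Ω Ω'
      have h' := Finset.sum_union_inter (s₁ := Ω 0) (s₂ := Ω' 0) (f := fun j => (ℓ₁ j : ℤ))
      have e₁ : (Ω ⊔ Ω') 0 = Ω 0 ∪ Ω' 0 := rfl
      have e₂ : (Ω ⊓ Ω') 0 = Ω 0 ∩ Ω' 0 := rfl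
      rw [e₁, e₂]
      linarith
  · refine sInf_fiber_add_le hcB hpB fun Ω Ω' hΩ hΩ' => ⟨Ω ⊓ Ω', Ω ⊔ Ω', ?_, ?_, ?_⟩
    · simp only [Pi.inf_apply, Finset.inf_eq_inter, ← hΩ, ← hΩ']
    · simp only [Pi.sup_apply, Finset.sup_eq_union, ← hΩ, ← hΩ']
    · have h := sum_blockRank_submodular G rblk cblk
        (Finset.univ.filter (fun i : Fin M => (K : ℕ) ≤ (i : ℕ))) Ω Ω'
      have h' := Finset.sum_union_inter (s₁ := (Ω (Fin.last M))ᶜ) (s₂ := (Ω' (Fin.last M))ᶜ)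
        (f := fun k => (ℓM k : ℤ))
      have e₁ : ((Ω ⊔ Ω') (Fin.last M))ᶜ = (Ω (Fin.last M))ᶜ ∩ (Ω' (Fin.last M))ᶜ :=
        Finset.compl_union _ _
      have e₂ : ((Ω ⊓ Ω') (Fin.last M))ᶜ = (Ω (Fin.last M))ᶜ ∪ (Ω' (Fin.last M))ᶜ :=
        Finset.compl_inter _ _
      rw [e₁, e₂]
      linarith
  · refine sInf_fiber_mono hcA hpA fun Ω hΩ => ⟨Function.update Ω K T₁ᶜ, ?_, ?_⟩
    · simp
    · have hle : Ω ≤ Function.update Ω K T₁ᶜ := by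
        refine le_update_iff.2 ⟨?_, fun _ _ => le_rfl⟩
        rw [← Finset.compl_eq_univ_sdiff] at hΩ
        rw [← compl_compl (Ω K), hΩ]
        exact Finset.compl_subset_compl.2 hT
      have h0 : (0 : Fin (M + 1)) ≠ K := by
        rintro rfl
        simp at hK1
      rw [Function.update_of_ne h0]
      gcongr with i hi
      have hiK : i.castSucc ≠ K := by
        rintro rfl
        simp at hi
      rw [Function.update_of_ne hiK]
      exact blockRank_mono _ _ _ (Finset.compl_subset_compl.2 (hle i.succ)) subset_rfl
  · refine sInf_fiber_mono hcB hpB fun Ω hΩ => ⟨Function.update Ω K T₁, ?_, ?_⟩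
    · simp
    · have hle : Function.update Ω K T₁ ≤ Ω :=
        update_le_iff.2 ⟨hΩ ▸ hT, fun _ _ => le_rfl⟩
      have hlast : Fin.last M ≠ K := by
        rintro rfl
        simp at hK2
      rw [Function.update_of_ne hlast]
      gcongr with i hi
      have hiK : i.succ ≠ K := by
        rintro rfl
        simp at hi
      rw [Function.update_of_ne hiK]
      exact blockRank_mono _ _ _ subset_rfl (hle i.castSucc)
  · refine sInf_fiber_eq_zero hcA (a := fun _ => Finset.univ) (by simp) ?_
    simp [blockRank_empty_left, ← h₁]
  · refine sInf_fiber_eq_zero hcB (a := fun _ => ∅) rfl ?_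
    simp [blockRank_empty_right, ← hM']
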